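/- Fix s>0 with 2s∈ℕ, 0<ρ_l<ρ_r<∞, and h∈ℝ with h≠0 and e^h < 1+1/ρ_r. Let Ψ^{(1)}_N(h) = Σ_{η∈ℕ^N} μ_{N,ρ_l,ρ_r}(η) e^{h(η_1+⋯+η_N)}. Then lim_{N→∞} (1/N)·log Ψ^{(1)}_N(h) = 2s·log( (1/((ρ_r−ρ_l)(1−e^h))) · log( (1+(1−e^h)ρ_r) / (1+(1−e^h)ρ_l) ) ). -/

import Mathlib

/-- The ordered simplex `{θ : ρ_l ≤ θ_1 ≤ θ_2 ≤ … ≤ θ_N ≤ ρ_r}`, the region of the nested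
integral `∫_{ρ_l}^{ρ_r}dθ_1 ∫_{θ_1}^{ρ_r}dθ_2 ⋯ ∫_{θ_{N−1}}^{ρ_r}dθ_N`. -/
def simplexSet (N : ℕ) (ρl ρr : ℝ) : Set (Fin N → ℝ) :=
  {θ | (∀ i j : Fin N, i ≤ j → θ i ≤ θ j) ∧ ∀ i, ρl ≤ θ i ∧ θ i ≤ ρr}

/-- The extended chain `(θ_0, θ_1, …, θ_N, θ_{N+1})` with the conventions `θ_0 = ρ_l`,
`θ_{N+1} = ρ_r`. -/
noncomputable def chainExt (ρl ρr : ℝ) {N : ℕ} (θ : Fin N → ℝ) : Fin (N + 2) → ℝ :=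
  Fin.snoc (Fin.cons ρl θ) ρr

/-- The product of the consecutive gaps: `∏_{i=1}^{N+1} (θ_i − θ_{i−1})^{2s−1}` with the
conventions `θ_0 = ρ_l`, `θ_{N+1} = ρ_r`. -/
noncomputable def gapProd (s ρl ρr : ℝ) {N : ℕ} (θ : Fin N → ℝ) : ℝ :=
  ∏ i : Fin (N + 1),
    (chainExt ρl ρr θ i.succ - chainExt ρl ρr θ i.castSucc) ^ (2 * s - 1)

/-- The Negative Binomial probability mass function with shape parameter `2s` and scale `θ`:
`ν_θ(m) = (Γ(2s+m)/(m!·Γ(2s)))·(θ/(1+θ))^m·(1+θ)^{−2s}`. -/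
noncomputable def negBin (s θ : ℝ) (m : ℕ) : ℝ :=
  (Real.Gamma (2 * s + (m : ℝ)) / ((m.factorial : ℝ) * Real.Gamma (2 * s)))
    * (θ / (1 + θ)) ^ m * (1 + θ) ^ (-(2 * s))

/-- The mixture measure (non-equilibrium steady state of the open harmonic process):
`μ_{N,ρ_l,ρ_r}(η) = [Γ(2s(N+1))/(Γ(2s)^{N+1}(ρ_r−ρ_l)^{2s(N+1)−1})] ·
∫_{ρ_l}^{ρ_r}dθ_1 ⋯ ∫_{θ_{N−1}}^{ρ_r}dθ_N ∏_{i=1}^{N+1}(θ_i−θ_{i−1})^{2s−1}·∏_{i=1}^{N}ν_{θ_i}(η_i)`,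
with `θ_0 = ρ_l`, `θ_{N+1} = ρ_r`, the nested integral being the integral over the ordered
simplex. -/
noncomputable def mixtureMeasure (s ρl ρr : ℝ) (N : ℕ) (η : Fin N → ℕ) : ℝ :=
  (Real.Gamma (2 * s * ((N : ℝ) + 1)) /
      (Real.Gamma (2 * s) ^ (N + 1) * (ρr - ρl) ^ (2 * s * ((N : ℝ) + 1) - 1))) *
    ∫ θ in simplexSet N ρl ρr,
      gapProd s ρl ρr θ * ∏ i : Fin N, negBin s (θ i) (η i)

open MeasureTheory ENNReal

theorem chainExt_snoc (a b x : ℝ) {N : ℕ} (θ : Fin N → ℝ) :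
    chainExt a b (Fin.snoc θ x : Fin (N + 1) → ℝ) = Fin.snoc (chainExt a x θ) b := by
  unfold chainExt
  rw [Fin.cons_snoc_eq_snoc_cons]

theorem gapProd_snoc (s a b x : ℝ) {N : ℕ} (θ : Fin N → ℝ) :
    gapProd s a b (Fin.snoc θ x : Fin (N + 1) → ℝ)
      = (b - x) ^ (2 * s - 1) * gapProd s a x θ := by
  unfold gapProd
  rw [Fin.prod_univ_castSucc, chainExt_snoc, mul_comm]
  congr 1
  · rw [Fin.succ_last, Fin.snoc_last, Fin.snoc_castSucc]
    simp [chainExt]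
  · refine Finset.prod_congr rfl fun i _ => ?_
    rw [← Fin.castSucc_succ, Fin.snoc_castSucc, Fin.snoc_castSucc]

theorem gapProd_of_isEmpty (s a b : ℝ) (θ : Fin 0 → ℝ) :
    gapProd s a b θ = (b - a) ^ (2 * s - 1) := by
  simp [gapProd, chainExt, Fin.snoc]

theorem snoc_mem_simplexSet {a b x : ℝ} {N : ℕ} {θ : Fin N → ℝ} :
    (Fin.snoc θ x : Fin (N + 1) → ℝ) ∈ simplexSet (N + 1) a b
      ↔ x ∈ Set.Icc a b ∧ θ ∈ simplexSet N a x := by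
  constructor
  · rintro ⟨hmono, hb⟩
    refine ⟨by simpa using hb (Fin.last N), fun i j hij => ?_, fun i => ⟨?_, ?_⟩⟩
    · simpa using hmono i.castSucc j.castSucc (by simpa using hij)
    · simpa using (hb i.castSucc).1
    · simpa using hmono i.castSucc (Fin.last N) (Fin.le_last _)
  · rintro ⟨hx, hmono, hb⟩
    refine ⟨fun i j => ?_, fun i => ?_⟩
    · induction i using Fin.lastCases with
      | last =>
        intro hij
        rw [Fin.last_le_iff.mp hij]
      | cast i =>
        induction j using Fin.lastCases with
        | last => intro _; simpa using (hb i).2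
        | cast j => intro hij; simpa using hmono i j (by simpa using hij)
    · induction i using Fin.lastCases with
      | last => simpa using hx
      | cast i => simpa using ⟨(hb i).1, (hb i).2.trans hx.2⟩

theorem measurableSet_simplexSet (N : ℕ) (a b : ℝ) : MeasurableSet (simplexSet N a b) := by
  apply IsClosed.measurableSet
  simp only [simplexSet, Set.ofPred_and, Set.ofPred_forall]
  refine .inter ?_ ?_
  · exact isClosed_iInter fun i => isClosed_iInter fun j => isClosed_iInter fun _ =>
      isClosed_le (by fun_prop) (by fun_prop)
  · exact isClosed_iInter fun i => .inter (isClosed_le (by fun_prop) (by fun_prop))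
      (isClosed_le (by fun_prop) (by fun_prop))

theorem measurable_gapProd (s a b : ℝ) (N : ℕ) :
    Measurable (gapProd s a b : (Fin N → ℝ) → ℝ) := by
  have hchain (j : Fin (N + 2)) : Measurable fun θ : Fin N → ℝ => chainExt a b θ j := by
    unfold chainExt
    induction j using Fin.lastCases with
    | last => simp
    | cast j =>
      simp only [Fin.snoc_castSucc]
      induction j using Fin.cases with
      | zero => simp
      | succ j => simpa using measurable_pi_apply j
  unfold gapProd
  fun_prop

theorem gapProd_nonneg (s a : ℝ) {N : ℕ} {b : ℝ} (hab : a ≤ b) {θ : Fin N → ℝ}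
    (hθ : θ ∈ simplexSet N a b) : 0 ≤ gapProd s a b θ := by
  induction N generalizing b with
  | zero =>
    rw [gapProd_of_isEmpty]
    exact Real.rpow_nonneg (by linarith) _
  | succ N ih =>
    rw [← Fin.snoc_init_self θ] at hθ ⊢
    obtain ⟨hx, hθ⟩ := snoc_mem_simplexSet.mp hθ
    rw [gapProd_snoc]
    exact mul_nonneg (Real.rpow_nonneg (by linarith [hx.2]) _) (ih hx.1 hθ)

theorem lintegral_fin_succ_snoc {N : ℕ} {F : (Fin (N + 1) → ℝ) → ℝ≥0∞} (hF : Measurable F) :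
    ∫⁻ θ, F θ = ∫⁻ x : ℝ, ∫⁻ θ : Fin N → ℝ, F (Fin.snoc θ x) := by
  have hmp := (volume_preserving_piFinSuccAbove (fun _ : Fin (N + 1) => ℝ) (Fin.last N)).symm
  rw [← hmp.lintegral_comp hF, Measure.volume_eq_prod, lintegral_prod]
  · refine lintegral_congr fun x => lintegral_congr fun θ => ?_
    rw [MeasurableEquiv.piFinSuccAbove_symm_apply, Fin.insertNthEquiv_last]
    rfl
  · exact (hF.comp (MeasurableEquiv.measurable _)).aemeasurable

/-- The integral over the ordered simplex of the product of the gaps against a product of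
one-site weights. -/
noncomputable def simplexWeight (s a : ℝ) (w : ℝ → ℝ≥0∞) (N : ℕ) (b : ℝ) : ℝ≥0∞ :=
  ∫⁻ θ in simplexSet N a b, ENNReal.ofReal (gapProd s a b θ) * ∏ i, w (θ i)

theorem simplexWeight_zero (s a : ℝ) (w : ℝ → ℝ≥0∞) (b : ℝ) :
    simplexWeight s a w 0 b = ENNReal.ofReal ((b - a) ^ (2 * s - 1)) := by
  have : simplexSet 0 a b = Set.univ := by ext; simp [simplexSet]
  simp [simplexWeight, this, gapProd_of_isEmpty, volume_pi]

theorem simplexWeight_succ (s a : ℝ) {w : ℝ → ℝ≥0∞} (hw : Measurable w) (N : ℕ) (b : ℝ) :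
    simplexWeight s a w (N + 1) b
      = ∫⁻ x in Set.Icc a b,
          ENNReal.ofReal ((b - x) ^ (2 * s - 1)) * w x * simplexWeight s a w N x := by
  have hmeas (N : ℕ) (b : ℝ) : Measurable fun θ : Fin N → ℝ =>
      ENNReal.ofReal (gapProd s a b θ) * ∏ i, w (θ i) := by
    have := measurable_gapProd s a b N
    fun_prop
  unfold simplexWeight
  rw [← lintegral_indicator (measurableSet_simplexSet _ _ _),
    lintegral_fin_succ_snoc ((hmeas _ _).indicator (measurableSet_simplexSet _ _ _)),
    ← lintegral_indicator measurableSet_Icc]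
  refine lintegral_congr fun x => ?_
  by_cases hx : x ∈ Set.Icc a b
  · rw [Set.indicator_of_mem hx, ← lintegral_const_mul _ (hmeas _ _),
      ← lintegral_indicator (measurableSet_simplexSet _ _ _)]
    refine lintegral_congr fun θ => ?_
    by_cases hθ : θ ∈ simplexSet N a x
    · rw [Set.indicator_of_mem (snoc_mem_simplexSet.mpr ⟨hx, hθ⟩), Set.indicator_of_mem hθ,
        gapProd_snoc, ENNReal.ofReal_mul (Real.rpow_nonneg (by linarith [hx.2]) _),
        Fin.prod_univ_castSucc]
      simp only [Fin.snoc_castSucc, Fin.snoc_last]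
      ring
    · rw [Set.indicator_of_notMem (fun h => hθ (snoc_mem_simplexSet.mp h).2),
        Set.indicator_of_notMem hθ]
  · rw [Set.indicator_of_notMem hx]
    have (θ : Fin N → ℝ) : (Fin.snoc θ x : Fin (N + 1) → ℝ) ∉ simplexSet (N + 1) a b :=
      fun h => hx (snoc_mem_simplexSet.mp h).1
    simp [this]

theorem ENNReal.tsum_pi_prod {N : ℕ} (g : Fin N → ℕ → ℝ≥0∞) :
    ∑' η : Fin N → ℕ, ∏ i, g i (η i) = ∏ i, ∑' n, g i n := by
  induction N with
  | zero => simp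
  | succ N ih =>
    rw [← (Fin.consEquiv fun _ : Fin (N + 1) => ℕ).tsum_eq, ENNReal.tsum_prod', Fin.prod_univ_succ,
      ← ih, ← ENNReal.tsum_mul_right]
    refine tsum_congr fun n => ?_
    rw [← ENNReal.tsum_mul_left]
    simp [Fin.consEquiv, Fin.prod_univ_succ]

/-- Iterated integrals over `[a, b]` of a transition kernel `K` with one-site density `f`. -/
noncomputable def iterKernel (a : ℝ) (f : ℝ → ℝ) (K : ℝ → ℝ → ℝ) : ℕ → ℝ → ℝ≥0∞
  | 0, b => ENNReal.ofReal (K b a)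
  | N + 1, b => ∫⁻ x in Set.Icc a b,
      ENNReal.ofReal (K b x) * ENNReal.ofReal (f x) * iterKernel a f K N x

theorem iterKernel_mono {a R : ℝ} {f : ℝ → ℝ} {K K' : ℝ → ℝ → ℝ}
    (hK : ∀ x y, a ≤ x → x ≤ y → y ≤ R → K y x ≤ K' y x) (N : ℕ) {b : ℝ} (hab : a ≤ b)
    (hbR : b ≤ R) : iterKernel a f K N b ≤ iterKernel a f K' N b := by
  induction N generalizing b with
  | zero => exact ENNReal.ofReal_le_ofReal (hK a b le_rfl hab hbR)
  | succ N ih =>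
    refine setLIntegral_mono' measurableSet_Icc fun x hx => ?_
    gcongr
    · exact hK x b hx.1 hx.2 hbR
    · exact ih hx.1 (hx.2.trans hbR)

section

variable {s a R : ℝ} {k : ℕ} {f : ℝ → ℝ} {w : ℝ → ℝ≥0∞}

theorem iterKernel_right_eq (hk : 2 * s - 1 = k) (hf : ∀ x ∈ Set.Icc a R, 0 ≤ f x)
    (hw : Measurable w) (hwf : ∀ x ∈ Set.Icc a R, w x = ENNReal.ofReal (f x ^ (k + 1)))
    (N : ℕ) {b : ℝ} (hab : a ≤ b) (hbR : b ≤ R) :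
    iterKernel a f (fun y x => (f y * (y - x)) ^ k) N b
      = ENNReal.ofReal (f b ^ k) * simplexWeight s a w N b := by
  induction N generalizing b with
  | zero =>
    rw [simplexWeight_zero, hk, Real.rpow_natCast, iterKernel, mul_pow,
      ENNReal.ofReal_mul (pow_nonneg (hf b ⟨hab, hbR⟩) _)]
  | succ N ih =>
    rw [simplexWeight_succ s a hw, iterKernel, ← lintegral_const_mul' _ _ ENNReal.ofReal_ne_top]
    refine setLIntegral_congr_fun measurableSet_Icc fun x hx => ?_
    have hfx := hf x ⟨hx.1, hx.2.trans hbR⟩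
    rw [ih hx.1 (hx.2.trans hbR), hwf x ⟨hx.1, hx.2.trans hbR⟩, hk, Real.rpow_natCast, mul_pow,
      ENNReal.ofReal_mul (pow_nonneg (hf b ⟨hab, hbR⟩) _), pow_succ,
      ENNReal.ofReal_mul (pow_nonneg hfx _)]
    ring

theorem iterKernel_left_eq (hk : 2 * s - 1 = k) (hf : ∀ x ∈ Set.Icc a R, 0 ≤ f x)
    (hw : Measurable w) (hwf : ∀ x ∈ Set.Icc a R, w x = ENNReal.ofReal (f x ^ (k + 1)))
    (N : ℕ) {b : ℝ} (hab : a ≤ b) (hbR : b ≤ R) :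
    iterKernel a f (fun y x => (f x * (y - x)) ^ k) N b
      = ENNReal.ofReal (f a ^ k) * simplexWeight s a w N b := by
  induction N generalizing b with
  | zero =>
    rw [simplexWeight_zero, hk, Real.rpow_natCast, iterKernel, mul_pow,
      ENNReal.ofReal_mul (pow_nonneg (hf a ⟨le_rfl, hab.trans hbR⟩) _)]
  | succ N ih =>
    rw [simplexWeight_succ s a hw, iterKernel, ← lintegral_const_mul' _ _ ENNReal.ofReal_ne_top]
    refine setLIntegral_congr_fun measurableSet_Icc fun x hx => ?_
    have hfx := hf x ⟨hx.1, hx.2.trans hbR⟩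
    rw [ih hx.1 (hx.2.trans hbR), hwf x ⟨hx.1, hx.2.trans hbR⟩, hk, Real.rpow_natCast, mul_pow,
      ENNReal.ofReal_mul (pow_nonneg hfx _), pow_succ, ENNReal.ofReal_mul (pow_nonneg hfx _)]
    ring

end

section

variable {a b : ℝ} {f φ : ℝ → ℝ}

theorem integral_sub_pow_mul_sub_pow_mul_deriv (hab : a ≤ b)
    (hφ : ∀ x ∈ Set.Icc a b, HasDerivAt φ (f x) x) (hf : ContinuousOn f (Set.Icc a b))
    (k p : ℕ) :
    ∫ x in a..b, (φ b - φ x) ^ k * f x * (φ x - φ a) ^ p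
      = k.factorial * p.factorial / (k + p + 1).factorial * (φ b - φ a) ^ (k + p + 1) := by
  have hφc : ContinuousOn φ (Set.Icc a b) := fun x hx => (hφ x hx).continuousAt.continuousWithinAt
  have hint (k p : ℕ) : IntervalIntegrable (fun x => (φ b - φ x) ^ k * f x * (φ x - φ a) ^ p)
      volume a b := by
    apply ContinuousOn.intervalIntegrable
    rw [Set.uIcc_of_le hab]
    fun_prop
  induction k generalizing p with
  | zero =>
    have h := intervalIntegral.integral_eq_sub_of_hasDerivAt
      (f := fun x => (φ x - φ a) ^ (p + 1) / (p + 1))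
      (f' := fun x => (φ b - φ x) ^ 0 * f x * (φ x - φ a) ^ p) (a := a) (b := b) ?_ (hint 0 p)
    · rw [h]
      simp only [sub_self, zero_add, Nat.factorial_succ, Nat.factorial_zero]
      have := Nat.factorial_ne_zero p
      push_cast
      field_simp
      simp
    · intro x hx
      rw [Set.uIcc_of_le hab] at hx
      refine ((((hφ x hx).sub_const (φ a)).pow (p + 1)).div_const ((p : ℝ) + 1)).congr_deriv ?_
      push_cast
      field_simp
  | succ k ih =>
    have h := intervalIntegral.integral_eq_sub_of_hasDerivAt
      (f := fun x => (φ b - φ x) ^ (k + 1) * ((φ x - φ a) ^ (p + 1) / (p + 1)))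
      (f' := fun x => (φ b - φ x) ^ (k + 1) * f x * (φ x - φ a) ^ p
        - (k + 1) / (p + 1) * ((φ b - φ x) ^ k * f x * (φ x - φ a) ^ (p + 1))) (a := a) (b := b) ?_
      ((hint _ _).sub ((hint _ _).const_mul _))
    · rw [intervalIntegral.integral_sub (hint _ _) ((hint _ _).const_mul _),
        intervalIntegral.integral_const_mul, ih] at h
      simp only [sub_self, zero_pow (Nat.succ_ne_zero _), zero_mul, zero_div, mul_zero] at h
      rw [sub_eq_zero.mp h, show k + 1 + p + 1 = k + (p + 1) + 1 by ring, Nat.factorial_succ k,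
        Nat.factorial_succ p]
      push_cast
      field_simp
    · intro x hx
      rw [Set.uIcc_of_le hab] at hx
      refine ((((hφ x hx).const_sub (φ b)).pow (k + 1)).mul
        ((((hφ x hx).sub_const (φ a)).pow (p + 1)).div_const ((p : ℝ) + 1))).congr_deriv ?_
      push_cast
      simp only [Pi.pow_apply]
      field_simp
      ring

theorem iterKernel_deriv_eq {R : ℝ} {k : ℕ} (hφ : ∀ x ∈ Set.Icc a R, HasDerivAt φ (f x) x)
    (hf : ContinuousOn f (Set.Icc a R)) (hf0 : ∀ x ∈ Set.Icc a R, 0 ≤ f x)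
    (hmono : MonotoneOn φ (Set.Icc a R)) (N : ℕ) {b : ℝ} (hab : a ≤ b) (hbR : b ≤ R) :
    iterKernel a f (fun y x => (φ y - φ x) ^ k) N b
      = ENNReal.ofReal (k.factorial ^ (N + 1) / (k + (k + 1) * N).factorial
          * (φ b - φ a) ^ (k + (k + 1) * N)) := by
  induction N generalizing b with
  | zero =>
    have := Nat.factorial_ne_zero k
    simp [iterKernel]
    field_simp
  | succ N ih =>
    have hsub : Set.Icc a b ⊆ Set.Icc a R := Set.Icc_subset_Icc_right hbR
    have hbm : b ∈ Set.Icc a R := ⟨hab, hbR⟩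
    have ham : a ∈ Set.Icc a R := ⟨le_rfl, hab.trans hbR⟩
    have hnn : ∀ x ∈ Set.Icc a b,
        0 ≤ (φ b - φ x) ^ k * f x * (φ x - φ a) ^ (k + (k + 1) * N) := fun x hx =>
      mul_nonneg (mul_nonneg (pow_nonneg (sub_nonneg.mpr (hmono (hsub hx) hbm hx.2)) _)
        (hf0 x (hsub hx))) (pow_nonneg (sub_nonneg.mpr (hmono ham (hsub hx) hx.1)) _)
    have hφc : ContinuousOn φ (Set.Icc a b) :=
      fun x hx => (hφ x (hsub hx)).continuousAt.continuousWithinAt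
    have hfc := hf.mono hsub
    have hint : IntegrableOn (fun x => (k.factorial ^ (N + 1) / (k + (k + 1) * N).factorial : ℝ) *
        ((φ b - φ x) ^ k * f x * (φ x - φ a) ^ (k + (k + 1) * N))) (Set.Icc a b) := by
      apply ContinuousOn.integrableOn_Icc
      fun_prop
    rw [iterKernel]
    trans ENNReal.ofReal (∫ x in Set.Icc a b,
      (k.factorial ^ (N + 1) / (k + (k + 1) * N).factorial : ℝ) *
        ((φ b - φ x) ^ k * f x * (φ x - φ a) ^ (k + (k + 1) * N)))
    · rw [ofReal_integral_eq_lintegral_ofReal hint]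
      · refine setLIntegral_congr_fun measurableSet_Icc fun x hx => ?_
        rw [ih hx.1 (hx.2.trans hbR), ← ENNReal.ofReal_mul, ← ENNReal.ofReal_mul]
        · ring_nf
        · exact mul_nonneg (pow_nonneg (sub_nonneg.mpr (hmono (hsub hx) hbm hx.2)) _)
            (hf0 x (hsub hx))
        · exact pow_nonneg (sub_nonneg.mpr (hmono (hsub hx) hbm hx.2)) _
      · refine (ae_restrict_iff' measurableSet_Icc).mpr (ae_of_all _ fun x hx => ?_)
        exact mul_nonneg (by positivity) (hnn x hx)
    · rw [integral_Icc_eq_integral_Ioc, ← intervalIntegral.integral_of_le hab,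
        intervalIntegral.integral_const_mul,
        integral_sub_pow_mul_sub_pow_mul_deriv hab (fun x hx => hφ x (hsub hx)) hfc,
        show k + (k + 1) * (N + 1) = k + (k + (k + 1) * N) + 1 by ring]
      congr 1
      have := Nat.factorial_ne_zero (k + (k + 1) * N)
      field_simp
      ring

end

theorem log_affine_sub_bounds {c x y : ℝ} (hx : 0 < 1 + c * x) (hy : 0 < 1 + c * y) :
    (1 + c * y)⁻¹ * (c * (y - x)) ≤ Real.log (1 + c * y) - Real.log (1 + c * x) ∧
      Real.log (1 + c * y) - Real.log (1 + c * x) ≤ (1 + c * x)⁻¹ * (c * (y - x)) := by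
  constructor
  · have h := Real.log_le_sub_one_of_pos (div_pos hx hy)
    rw [Real.log_div hx.ne' hy.ne'] at h
    have : (1 + c * x) / (1 + c * y) - 1 = -((1 + c * y)⁻¹ * (c * (y - x))) := by
      field_simp; ring
    linarith
  · have h := Real.log_le_sub_one_of_pos (div_pos hy hx)
    rw [Real.log_div hy.ne' hx.ne'] at h
    have : (1 + c * y) / (1 + c * x) - 1 = (1 + c * x)⁻¹ * (c * (y - x)) := by
      field_simp; ring
    linarith

theorem one_add_mul_pos_of_mem_Icc {a R c x : ℝ} (ha : 0 < 1 + c * a) (hR : 0 < 1 + c * R)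
    (hx : x ∈ Set.Icc a R) : 0 < 1 + c * x := by
  obtain hc | hc := le_total 0 c
  · nlinarith [hx.1]
  · nlinarith [hx.2]

theorem iterKernel_log_eq {a R c : ℝ} {k : ℕ} (hc : c ≠ 0) (haR : a ≤ R) (ha : 0 < 1 + c * a)
    (hR : 0 < 1 + c * R) (N : ℕ) :
    iterKernel a (fun x => (1 + c * x)⁻¹)
        (fun y x => (Real.log (1 + c * y) / c - Real.log (1 + c * x) / c) ^ k) N R
      = ENNReal.ofReal (k.factorial ^ (N + 1) / (k + (k + 1) * N).factorial
          * (Real.log (1 + c * R) / c - Real.log (1 + c * a) / c) ^ (k + (k + 1) * N)) := by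
  have hpos := fun x hx => one_add_mul_pos_of_mem_Icc (x := x) ha hR hx
  have hderiv : ∀ x ∈ Set.Icc a R,
      HasDerivAt (fun x => Real.log (1 + c * x) / c) (1 + c * x)⁻¹ x := fun x hx => by
    have := ((((hasDerivAt_id x).const_mul c).const_add 1).log (hpos x hx).ne').div_const c
    refine this.congr_deriv ?_
    simp only [id]
    field_simp
  refine iterKernel_deriv_eq (φ := fun x => Real.log (1 + c * x) / c) hderiv ?_
    (fun x hx => (inv_pos.mpr (hpos x hx)).le) ?_ N haR le_rfl
  · exact ContinuousOn.inv₀ (by fun_prop) fun x hx => (hpos x hx).ne'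
  · refine monotoneOn_of_deriv_nonneg (convex_Icc a R)
      (fun x hx => (hderiv x hx).continuousAt.continuousWithinAt) (fun x hx =>
        (hderiv x (interior_subset hx)).differentiableAt.differentiableWithinAt) fun x hx => ?_
    rw [(hderiv x (interior_subset hx)).deriv]
    exact (inv_pos.mpr (hpos x (interior_subset hx))).le

theorem exists_simplexWeight_bounds {s a R c : ℝ} {k : ℕ} {w : ℝ → ℝ≥0∞} (hk : 2 * s - 1 = k)
    (hc : c ≠ 0) (haR : a ≤ R) (ha : 0 < 1 + c * a) (hR : 0 < 1 + c * R) (hw : Measurable w)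
    (hwf : ∀ x ∈ Set.Icc a R, w x = ENNReal.ofReal ((1 + c * x)⁻¹ ^ (k + 1))) :
    ∃ A B : ℝ, 0 < A ∧ 0 < B ∧ ∀ N,
      ENNReal.ofReal A * simplexWeight s a w N R
          ≤ ENNReal.ofReal (k.factorial ^ (N + 1) / (k + (k + 1) * N).factorial
            * (Real.log (1 + c * R) / c - Real.log (1 + c * a) / c) ^ (k + (k + 1) * N)) ∧
        ENNReal.ofReal (k.factorial ^ (N + 1) / (k + (k + 1) * N).factorial
            * (Real.log (1 + c * R) / c - Real.log (1 + c * a) / c) ^ (k + (k + 1) * N))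
          ≤ ENNReal.ofReal B * simplexWeight s a w N R := by
  have hpos := fun x hx => one_add_mul_pos_of_mem_Icc (x := x) ha hR hx
  have hf0 : ∀ x ∈ Set.Icc a R, 0 ≤ (1 + c * x)⁻¹ := fun x hx => (inv_pos.mpr (hpos x hx)).le
  have hright := fun N => iterKernel_right_eq hk hf0 hw hwf N haR le_rfl
  have hleft := fun N => iterKernel_left_eq hk hf0 hw hwf N haR le_rfl
  obtain hc | hc := hc.lt_or_gt
  · have hbd : ∀ x y, a ≤ x → x ≤ y → y ≤ R →
        0 ≤ (1 + c * x)⁻¹ * (y - x) ∧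
        (1 + c * x)⁻¹ * (y - x) ≤ Real.log (1 + c * y) / c - Real.log (1 + c * x) / c ∧
        Real.log (1 + c * y) / c - Real.log (1 + c * x) / c ≤ (1 + c * y)⁻¹ * (y - x) := by
      intro x y hx hxy hy
      have hx' := hpos x ⟨hx, hxy.trans hy⟩
      have h := log_affine_sub_bounds hx' (hpos y ⟨hx.trans hxy, hy⟩)
      rw [← sub_div, le_div_iff_of_neg hc, div_le_iff_of_neg hc]
      exact ⟨mul_nonneg (inv_pos.mpr hx').le (by linarith), by linarith, by linarith⟩
    refine ⟨((1 + c * a)⁻¹) ^ k, ((1 + c * R)⁻¹) ^ k, by positivity, by positivity, fun N => ?_⟩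
    rw [← hright, ← hleft, ← iterKernel_log_eq hc.ne haR ha hR]
    refine ⟨iterKernel_mono (fun x y hx hxy hy => ?_) N haR le_rfl,
      iterKernel_mono (fun x y hx hxy hy => ?_) N haR le_rfl⟩ <;>
    obtain ⟨h1, h2, h3⟩ := hbd x y hx hxy hy
    · exact pow_le_pow_left₀ h1 h2 k
    · exact pow_le_pow_left₀ (h1.trans h2) h3 k
  · have hbd : ∀ x y, a ≤ x → x ≤ y → y ≤ R →
        0 ≤ (1 + c * y)⁻¹ * (y - x) ∧
        (1 + c * y)⁻¹ * (y - x) ≤ Real.log (1 + c * y) / c - Real.log (1 + c * x) / c ∧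
        Real.log (1 + c * y) / c - Real.log (1 + c * x) / c ≤ (1 + c * x)⁻¹ * (y - x) := by
      intro x y hx hxy hy
      have hy' := hpos y ⟨hx.trans hxy, hy⟩
      have h := log_affine_sub_bounds (hpos x ⟨hx, hxy.trans hy⟩) hy'
      rw [← sub_div, le_div_iff₀ hc, div_le_iff₀ hc]
      exact ⟨mul_nonneg (inv_pos.mpr hy').le (by linarith), by linarith, by linarith⟩
    refine ⟨((1 + c * R)⁻¹) ^ k, ((1 + c * a)⁻¹) ^ k, by positivity, by positivity, fun N => ?_⟩
    rw [← hright, ← hleft, ← iterKernel_log_eq hc.ne' haR ha hR]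
    refine ⟨iterKernel_mono (fun x y hx hxy hy => ?_) N haR le_rfl,
      iterKernel_mono (fun x y hx hxy hy => ?_) N haR le_rfl⟩ <;>
    obtain ⟨h1, h2, h3⟩ := hbd x y hx hxy hy
    · exact pow_le_pow_left₀ h1 h2 k
    · exact pow_le_pow_left₀ (h1.trans h2) h3 k

theorem negBin_nonneg {s θ : ℝ} (hs : 0 < s) (hθ : 0 ≤ θ) (n : ℕ) : 0 ≤ negBin s θ n := by
  have := Real.Gamma_pos_of_pos (show 0 < 2 * s by positivity)
  have := Real.Gamma_pos_of_pos (show 0 < 2 * s + n by positivity)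
  unfold negBin
  positivity

theorem measurable_negBin (s : ℝ) (n : ℕ) : Measurable fun θ => negBin s θ n := by
  unfold negBin
  fun_prop

theorem tsum_negBin_mul_exp {s θ h : ℝ} {k : ℕ} (hk : 2 * s = k + 1) (hθ : 0 ≤ θ)
    (hpos : 0 < 1 + (1 - Real.exp h) * θ) :
    ∑' n : ℕ, ENNReal.ofReal (negBin s θ n * Real.exp (h * n))
      = ENNReal.ofReal ((1 + (1 - Real.exp h) * θ)⁻¹ ^ (k + 1)) := by
  have hs : 0 < s := by have : (0 : ℝ) ≤ k := k.cast_nonneg; linarith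
  have h1 : (0 : ℝ) < 1 + θ := by linarith
  have hr0 : 0 ≤ θ / (1 + θ) * Real.exp h := by positivity
  have hr : ‖θ / (1 + θ) * Real.exp h‖ < 1 := by
    rw [Real.norm_of_nonneg hr0, div_mul_eq_mul_div, div_lt_one h1]
    linarith
  have hsum := (hasSum_choose_mul_geometric_of_norm_lt_one k hr).mul_left ((1 + θ) ^ (k + 1))⁻¹
  have heq : ((1 + θ) ^ (k + 1))⁻¹ * (1 / (1 - θ / (1 + θ) * Real.exp h) ^ (k + 1))
      = (1 + (1 - Real.exp h) * θ)⁻¹ ^ (k + 1) := by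
    rw [one_div, ← mul_inv, ← mul_pow, inv_pow]
    congr 3
    field_simp
    ring
  rw [heq] at hsum
  have hterm : (fun n : ℕ => ((1 + θ) ^ (k + 1))⁻¹ *
      (((n + k).choose k : ℝ) * (θ / (1 + θ) * Real.exp h) ^ n))
      = fun n : ℕ => negBin s θ n * Real.exp (h * n) := by
    funext n
    have hg : Real.Gamma (2 * s + n) = (n + k).factorial := by
      rw [← Real.Gamma_nat_eq_factorial, hk]
      push_cast
      ring_nf
    have hg' : Real.Gamma (2 * s) = k.factorial := by rw [← Real.Gamma_nat_eq_factorial, hk]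
    rw [negBin, hg, hg', hk, Real.rpow_neg h1.le, ← Nat.cast_add_one, Real.rpow_natCast,
      ← Nat.choose_symm_add, Nat.cast_add_choose, mul_pow, mul_comm h, Real.exp_nat_mul]
    ring
  rw [hterm] at hsum
  rw [← ENNReal.ofReal_tsum_of_nonneg (fun n => mul_nonneg (negBin_nonneg hs hθ n)
    (Real.exp_pos _).le) hsum.summable, hsum.tsum_eq]

theorem tsum_mixtureMeasure_mul_exp {s ρl ρr h : ℝ} (hs : 0 < s) (h0 : 0 ≤ ρl) (hlr : ρl ≤ ρr)
    (N : ℕ)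
    (hfin : simplexWeight s ρl
      (fun θ => ∑' n : ℕ, ENNReal.ofReal (negBin s θ n * Real.exp (h * n))) N ρr ≠ ∞) :
    ∑' η : Fin N → ℕ, mixtureMeasure s ρl ρr N η * Real.exp (h * ∑ i : Fin N, (η i : ℝ))
      = Real.Gamma (2 * s * ((N : ℝ) + 1)) /
          (Real.Gamma (2 * s) ^ (N + 1) * (ρr - ρl) ^ (2 * s * ((N : ℝ) + 1) - 1)) *
        (simplexWeight s ρl
          (fun θ => ∑' n : ℕ, ENNReal.ofReal (negBin s θ n * Real.exp (h * n))) N ρr).toReal := by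
  have hgap := measurable_gapProd s ρl ρr N
  have hneg := measurable_negBin s
  have hmeas (η : Fin N → ℕ) : Measurable fun θ : Fin N → ℝ =>
      gapProd s ρl ρr θ * ∏ i, (negBin s (θ i) (η i) * Real.exp (h * η i)) :=
    hgap.mul (Finset.measurable_prod _ fun i _ =>
      ((hneg (η i)).comp (measurable_pi_apply i)).mul_const _)
  have hnonneg (η : Fin N → ℕ) (θ : Fin N → ℝ) (hθ : θ ∈ simplexSet N ρl ρr) (i : Fin N) :
      0 ≤ negBin s (θ i) (η i) * Real.exp (h * η i) :=
    mul_nonneg (negBin_nonneg hs (h0.trans (hθ.2 i).1) _) (Real.exp_pos _).le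
  have hterm (η : Fin N → ℕ) :
      (∫ θ in simplexSet N ρl ρr, gapProd s ρl ρr θ * ∏ i : Fin N, negBin s (θ i) (η i))
          * Real.exp (h * ∑ i : Fin N, (η i : ℝ))
        = (∫⁻ θ in simplexSet N ρl ρr, ENNReal.ofReal (gapProd s ρl ρr θ) *
            ∏ i, ENNReal.ofReal (negBin s (θ i) (η i) * Real.exp (h * η i))).toReal := by
    rw [← integral_mul_const, Finset.mul_sum, Real.exp_sum]
    simp only [mul_assoc, ← Finset.prod_mul_distrib]
    rw [integral_eq_lintegral_of_nonneg_ae _ (hmeas η).aestronglyMeasurable]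
    · congr 1
      refine setLIntegral_congr_fun (measurableSet_simplexSet _ _ _) fun θ hθ => ?_
      rw [ENNReal.ofReal_mul (gapProd_nonneg s ρl hlr hθ),
        ENNReal.ofReal_prod_of_nonneg fun i _ => hnonneg η θ hθ i]
    · refine (ae_restrict_iff' (measurableSet_simplexSet _ _ _)).mpr (ae_of_all _ fun θ hθ => ?_)
      exact mul_nonneg (gapProd_nonneg s ρl hlr hθ)
        (Finset.prod_nonneg fun i _ => hnonneg η θ hθ i)
  have htotal : ∑' η : Fin N → ℕ, ∫⁻ θ in simplexSet N ρl ρr, ENNReal.ofReal (gapProd s ρl ρr θ) *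
        ∏ i, ENNReal.ofReal (negBin s (θ i) (η i) * Real.exp (h * η i))
      = simplexWeight s ρl
          (fun θ => ∑' n : ℕ, ENNReal.ofReal (negBin s θ n * Real.exp (h * n))) N ρr := by
    rw [← lintegral_tsum, simplexWeight]
    · simp only [ENNReal.tsum_mul_left]
      refine lintegral_congr fun θ => ?_
      rw [ENNReal.tsum_pi_prod fun i n => ENNReal.ofReal (negBin s (θ i) n * Real.exp (h * n))]
    · exact fun η => (hgap.ennreal_ofReal.mul (Finset.measurable_prod _ fun i _ =>
        (((hneg (η i)).comp (measurable_pi_apply i)).mul_const _).ennreal_ofReal)).aemeasurable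
  simp only [mixtureMeasure, mul_assoc, hterm]
  rw [tsum_mul_left, ← ENNReal.tsum_toReal_eq, htotal]
  exact ENNReal.ne_top_of_tsum_ne_top (htotal ▸ hfin)

theorem tendsto_log_div_of_pow_bounds {Ψ : ℕ → ℝ} {Q A B : ℝ} {k : ℕ} (hQ : 0 < Q) (hA : 0 < A)
    (hB : 0 < B) (hlow : ∀ N, A * Q ^ (k + (k + 1) * N) ≤ Ψ N)
    (hup : ∀ N, Ψ N ≤ B * Q ^ (k + (k + 1) * N)) :
    Filter.Tendsto (fun N : ℕ => 1 / (N : ℝ) * Real.log (Ψ N)) Filter.atTop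
      (nhds ((k + 1) * Real.log Q)) := by
  have hlog {C : ℝ} (hC : 0 < C) (N : ℕ) : Real.log (C * Q ^ (k + (k + 1) * N))
      = Real.log C + k * Real.log Q + N * ((k + 1) * Real.log Q) := by
    rw [Real.log_mul hC.ne' (by positivity), Real.log_pow]
    push_cast
    ring
  have hlim {C : ℝ} (hC : 0 < C) : Filter.Tendsto
      (fun N : ℕ => 1 / (N : ℝ) * Real.log (C * Q ^ (k + (k + 1) * N))) Filter.atTop
      (nhds ((k + 1) * Real.log Q)) := by
    have h := (tendsto_const_div_atTop_nhds_zero_nat (Real.log C + k * Real.log Q)).add_const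
      ((k + 1) * Real.log Q)
    rw [zero_add] at h
    refine h.congr' ?_
    filter_upwards [Filter.eventually_gt_atTop 0] with N hN
    rw [hlog hC]
    field_simp
  refine tendsto_of_tendsto_of_tendsto_of_le_of_le (hlim hA) (hlim hB) (fun N => ?_) fun N => ?_
  · have := hlow N
    dsimp only
    gcongr
  · have := hup N
    have : 0 < Ψ N := lt_of_lt_of_le (by positivity) (hlow N)
    dsimp only
    gcongr

/-- Infinite-volume pressure for a constant field `h`: for `2s ∈ ℕ`, `0 < ρ_l < ρ_r`, `h ≠ 0`
and `e^h < 1+1/ρ_r`,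
`lim_{N→∞} (1/N) log Σ_η μ_{N,ρ_l,ρ_r}(η) e^{h(η_1+⋯+η_N)}
= 2s·log( (1/((ρ_r−ρ_l)(1−e^h)))·log((1+(1−e^h)ρ_r)/(1+(1−e^h)ρ_l)) )`. -/
theorem pressure_constant_field (s : ℝ) (hs : 0 < s) (hm : ∃ m : ℕ, (m : ℝ) = 2 * s)
    (ρl ρr : ℝ) (h0 : 0 < ρl) (hlr : ρl < ρr) (h : ℝ) (hne : h ≠ 0)
    (hub : Real.exp h < 1 + 1 / ρr) :
    Filter.Tendsto
      (fun N : ℕ => (1 / (N : ℝ)) *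
        Real.log (∑' η : Fin N → ℕ,
          mixtureMeasure s ρl ρr N η * Real.exp (h * ∑ i : Fin N, (η i : ℝ))))
      Filter.atTop
      (nhds (2 * s * Real.log ((1 / ((ρr - ρl) * (1 - Real.exp h))) *
        Real.log ((1 + (1 - Real.exp h) * ρr) / (1 + (1 - Real.exp h) * ρl))))) := by
  obtain ⟨m, hm⟩ := hm
  obtain ⟨k, rfl⟩ : ∃ k, m = k + 1 := Nat.exists_eq_succ_of_ne_zero (by
    rintro rfl
    rw [Nat.cast_zero] at hm
    linarith)
  push_cast at hm
  set c := 1 - Real.exp h with hc_def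
  have hc : c ≠ 0 := fun hc => hne (Real.exp_eq_one_iff h |>.mp (by linarith))
  have h0r : 0 < ρr := h0.trans hlr
  have hR : 0 < 1 + c * ρr := by
    have := mul_lt_mul_of_pos_right hub h0r
    rw [add_mul, one_div_mul_cancel h0r.ne'] at this
    linarith
  have ha : 0 < 1 + c * ρl := one_add_mul_pos_of_mem_Icc (a := 0) (by simp) hR ⟨h0.le, hlr.le⟩
  set w : ℝ → ℝ≥0∞ := fun θ => ∑' n : ℕ, ENNReal.ofReal (negBin s θ n * Real.exp (h * n))
  have hw : Measurable w :=
    Measurable.tsum fun n => ((measurable_negBin s n).mul_const _).ennreal_ofReal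
  have hwf : ∀ x ∈ Set.Icc ρl ρr, w x = ENNReal.ofReal ((1 + c * x)⁻¹ ^ (k + 1)) := fun x hx =>
    tsum_negBin_mul_exp hm.symm (h0.le.trans hx.1) (one_add_mul_pos_of_mem_Icc ha hR hx)
  obtain ⟨A, B, hA, hB, hAB⟩ :=
    exists_simplexWeight_bounds (s := s) (by linarith) hc hlr.le ha hR hw hwf
  have hL : 0 < ρr - ρl := sub_pos.mpr hlr
  set P := Real.log (1 + c * ρr) / c - Real.log (1 + c * ρl) / c with hP_def
  have hP : 0 < P := by
    rw [hP_def, ← sub_div]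
    obtain hc' | hc' := hc.lt_or_gt
    · exact div_pos_of_neg_of_neg (sub_neg.mpr (Real.log_lt_log hR (by nlinarith))) hc'
    · exact div_pos (sub_pos.mpr (Real.log_lt_log ha (by nlinarith))) hc'
  have hlimit : 1 / ((ρr - ρl) * c) * Real.log ((1 + c * ρr) / (1 + c * ρl)) = P / (ρr - ρl) := by
    rw [Real.log_div hR.ne' ha.ne', hP_def]
    field_simp
  have hfin (N : ℕ) : simplexWeight s ρl w N ρr ≠ ∞ := fun htop => by
    have := (hAB N).1
    rw [htop, ENNReal.mul_top (by simpa using hA), top_le_iff] at this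
    exact ENNReal.ofReal_ne_top this
  have hconst (N : ℕ) : Real.Gamma (2 * s * ((N : ℝ) + 1)) /
      (Real.Gamma (2 * s) ^ (N + 1) * (ρr - ρl) ^ (2 * s * ((N : ℝ) + 1) - 1))
      = (k + (k + 1) * N).factorial / (k.factorial ^ (N + 1) * (ρr - ρl) ^ (k + (k + 1) * N)) := by
    have hexp : 2 * s * ((N : ℝ) + 1) - 1 = (k + (k + 1) * N : ℕ) := by
      rw [← hm]; push_cast; ring
    rw [hexp, Real.rpow_natCast, eq_add_of_sub_eq hexp, Real.Gamma_nat_eq_factorial, ← hm,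
      Real.Gamma_nat_eq_factorial]
  rw [hlimit, ← hm]
  refine tendsto_log_div_of_pow_bounds (div_pos hP hL) (inv_pos.mpr hB) (inv_pos.mpr hA)
    (fun N => ?_) fun N => ?_ <;>
  rw [tsum_mixtureMeasure_mul_exp hs h0.le hlr.le N (hfin N), hconst]
  · have h1 := ENNReal.toReal_mono (ENNReal.mul_ne_top ENNReal.ofReal_ne_top (hfin N)) (hAB N).2
    rw [ENNReal.toReal_mul, ENNReal.toReal_ofReal hB.le, ENNReal.toReal_ofReal (by positivity)]
      at h1
    rw [inv_mul_le_iff₀ hB]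
    calc (P / (ρr - ρl)) ^ (k + (k + 1) * N)
        = (k + (k + 1) * N).factorial / (k.factorial ^ (N + 1) * (ρr - ρl) ^ (k + (k + 1) * N))
          * (k.factorial ^ (N + 1) / (k + (k + 1) * N).factorial * P ^ (k + (k + 1) * N)) := by
          rw [div_pow]; field_simp
      _ ≤ _ := mul_le_mul_of_nonneg_left h1 (by positivity)
      _ = _ := by ring
  · have h1 := ENNReal.toReal_mono ENNReal.ofReal_ne_top (hAB N).1
    rw [ENNReal.toReal_mul, ENNReal.toReal_ofReal hA.le, ENNReal.toReal_ofReal (by positivity)]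
      at h1
    rw [← div_eq_inv_mul, le_div_iff₀ hA]
    calc _ = (k + (k + 1) * N).factorial / (k.factorial ^ (N + 1) * (ρr - ρl) ^ (k + (k + 1) * N))
          * (A * (simplexWeight s ρl w N ρr).toReal) := by ring
      _ ≤ (k + (k + 1) * N).factorial / (k.factorial ^ (N + 1) * (ρr - ρl) ^ (k + (k + 1) * N))
          * (k.factorial ^ (N + 1) / (k + (k + 1) * N).factorial * P ^ (k + (k + 1) * N)) :=
          mul_le_mul_of_nonneg_left h1 (by positivity)
      _ = (P / (ρr - ρl)) ^ (k + (k + 1) * N) := by rw [div_pow]; field_simp
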